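/- arXiv:1703.03984 — 2 statements merged into one kernel-verified Lean document; each statement's English description precedes it below -/
import Mathlib

section
/- Let G be a connected graph of order n ≥ 3. Then sdiam_{n−1}(G) = n − 2 if and only if G is 2-connected. -/
open SimpleGraph

/-- The Steiner distance of a vertex set `S` in `G`: the minimum number of edges of a
connected subgraph of `G` whose vertex set contains `S` (`⊤` if no such subgraph exists). -/
noncomputable def steinerDist {V : Type*} (G : SimpleGraph V) (S : Set V) : ℕ∞ :=
  sInf {m : ℕ∞ | ∃ H : G.Subgraph, H.Connected ∧ S ⊆ H.verts ∧ m = H.edgeSet.ncard}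

/-- The Steiner `k`-diameter of `G`: the maximum of `steinerDist G S` over all
`k`-element vertex subsets `S`. -/
noncomputable def sdiam {V : Type*} (G : SimpleGraph V) (k : ℕ) : ℕ∞ :=
  sSup {m : ℕ∞ | ∃ S : Set V, S.ncard = k ∧ m = steinerDist G S}

/-- `v` is a cut vertex of `G` if deleting `v` disconnects `G`. -/
def IsCutVertex {V : Type*} (G : SimpleGraph V) (v : V) : Prop :=
  ¬ (G.induce ({v}ᶜ : Set V)).Connected

/-- `U` is a vertex cut set of the induced subgraph `G[A]` if `U ⊆ A` and deleting `U`
from `G[A]` leaves a disconnected graph. -/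
def IsCutSetOf {V : Type*} (G : SimpleGraph V) (A U : Set V) : Prop :=
  U ⊆ A ∧ ¬ (G.induce (A \ U)).Connected

/-- The vertex connectivity of the induced subgraph `G[A]`: the minimum size of a set
`U ⊆ A` whose removal disconnects `G[A]` or reduces it to a single vertex. -/
noncomputable def kappaOn {V : Type*} (G : SimpleGraph V) (A : Set V) : ℕ :=
  sInf {m : ℕ | ∃ U : Set V, U ⊆ A ∧ U.ncard = m ∧
    (¬ (G.induce (A \ U)).Connected ∨ (A \ U).ncard = 1)}

/-- The vertex connectivity `κ(G)`. -/
noncomputable def kappa {V : Type*} (G : SimpleGraph V) : ℕ :=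
  kappaOn G Set.univ

theorem SimpleGraph.Subgraph.ncard_edgeSet_eq_card_coe {V : Type*} {G : SimpleGraph V}
    (H : G.Subgraph) : H.edgeSet.ncard = Nat.card H.coe.edgeSet := by
  rw [← H.image_coe_edgeSet_coe,
    Set.ncard_image_of_injective _ (Sym2.map.injective Subtype.val_injective),
    Nat.card_coe_set_eq]

theorem SimpleGraph.Subgraph.Connected.ncard_verts_le {V : Type*} {G : SimpleGraph V}
    {H : G.Subgraph} (hH : H.Connected) : H.verts.ncard ≤ H.edgeSet.ncard + 1 := by
  rw [H.ncard_edgeSet_eq_card_coe, ← Nat.card_coe_set_eq]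
  exact hH.coe.card_vert_le_card_edgeSet_add_one

/-- A connected induced subgraph has a spanning tree, viewed as a subgraph of `G`. -/
theorem SimpleGraph.exists_subgraph_connected_verts_eq {V : Type*} [Finite V]
    {G : SimpleGraph V} {S : Set V} (hS : (G.induce S).Connected) :
    ∃ H : G.Subgraph, H.Connected ∧ H.verts = S ∧ H.edgeSet.ncard + 1 = S.ncard := by
  obtain ⟨T, hle, hT⟩ := hS.exists_isTree_le
  let H : G.Subgraph :=
    { verts := S
      Adj := fun a b => ∃ (ha : a ∈ S) (hb : b ∈ S), T.Adj ⟨a, ha⟩ ⟨b, hb⟩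
      adj_sub := fun ⟨_, _, h⟩ => hle h
      edge_vert := fun ⟨ha, _, _⟩ => ha
      symm := ⟨fun _ _ ⟨ha, hb, h⟩ => ⟨hb, ha, h.symm⟩⟩ }
  have hH : H.coe = T := by
    ext a b
    exact ⟨fun ⟨_, _, h⟩ => h, fun h => ⟨a.2, b.2, h⟩⟩
  obtain ⟨hconn, hcard⟩ := isTree_iff_connected_and_card.1 hT
  refine ⟨H, ⟨hH ▸ hconn⟩, rfl, ?_⟩
  rw [H.ncard_edgeSet_eq_card_coe, hH, ← Nat.card_coe_set_eq]
  exact hcard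

theorem ncard_le_steinerDist_add_one {V : Type*} [Finite V] (G : SimpleGraph V) (S : Set V) :
    (S.ncard : ℕ∞) ≤ steinerDist G S + 1 := by
  rw [← tsub_le_iff_right]
  refine le_sInf ?_
  rintro m ⟨H, hH, hSH, rfl⟩
  rw [tsub_le_iff_right]
  exact_mod_cast (Set.ncard_le_ncard hSH).trans hH.ncard_verts_le

theorem steinerDist_add_one_le_ncard_iff {V : Type*} [Finite V] (G : SimpleGraph V) (S : Set V) :
    steinerDist G S + 1 ≤ S.ncard ↔ (G.induce S).Connected := by
  constructor
  · intro h
    have hne : {m : ℕ∞ | ∃ H : G.Subgraph, H.Connected ∧ S ⊆ H.verts ∧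
        m = H.edgeSet.ncard}.Nonempty := by
      by_contra hempty
      rw [Set.not_nonempty_iff_eq_empty] at hempty
      rw [steinerDist, hempty, sInf_empty, top_add, top_le_iff] at h
      exact ENat.natCast_ne_top _ h
    obtain ⟨H, hH, hSH, hm⟩ := csInf_mem hne
    change steinerDist G S = _ at hm
    rw [hm] at h
    have hle : H.edgeSet.ncard + 1 ≤ S.ncard := by exact_mod_cast h
    have hS : S = H.verts := Set.eq_of_subset_of_ncard_le hSH (hH.ncard_verts_le.trans hle)
    rw [hS]
    exact hH.coe.mono fun _ _ => H.adj_sub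
  · intro h
    obtain ⟨H, hH, hv, hcard⟩ := exists_subgraph_connected_verts_eq h
    have hle : steinerDist G S ≤ H.edgeSet.ncard := sInf_le ⟨H, hH, hv.ge, rfl⟩
    rw [← hcard]
    push_cast
    gcongr

theorem two_le_kappa_iff {V : Type*} [Fintype V] {G : SimpleGraph V} (hG : G.Connected)
    (h3 : 3 ≤ Fintype.card V) :
    2 ≤ kappa G ↔ ∀ v, (G.induce ({v}ᶜ : Set V)).Connected := by
  have hcard (v : V) : ({v}ᶜ : Set V).ncard = Fintype.card V - 1 := by
    rw [Set.ncard_compl, Set.ncard_singleton, Nat.card_eq_fintype_card]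
  constructor
  · intro h v
    by_contra hv
    have : kappa G ≤ 1 := Nat.sInf_le
      ⟨{v}, Set.subset_univ _, Set.ncard_singleton v, .inl (by rwa [← Set.compl_eq_univ_sdiff])⟩
    omega
  · intro h
    obtain ⟨v⟩ := hG.nonempty
    refine le_csInf ⟨_, {v}ᶜ, Set.subset_univ _, rfl, .inr ?_⟩ ?_
    · rw [← Set.compl_eq_univ_sdiff, compl_compl, Set.ncard_singleton]
    · rintro m ⟨U, -, rfl, hU⟩
      rw [← Set.compl_eq_univ_sdiff] at hU
      by_contra! hlt
      have hcases : U.ncard = 0 ∨ U.ncard = 1 := by omega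
      rcases hcases with h0 | h1
      · rw [Set.ncard_eq_zero] at h0
        subst h0
        rcases hU with hU | hU
        · rw [Set.compl_empty] at hU
          exact hU (induceUnivIso G |>.connected_iff.2 hG)
        · rw [Set.compl_empty, Set.ncard_univ, Nat.card_eq_fintype_card] at hU
          omega
      · obtain ⟨w, rfl⟩ := Set.ncard_eq_one.1 h1
        rcases hU with hU | hU
        · exact hU (h w)
        · rw [hcard] at hU
          omega

/-- For a connected graph `G` of order `n ≥ 3`, `sdiam_{n-1}(G) = n - 2`
if and only if `G` is 2-connected. -/
theorem sdiam_pred_eq_iff_two_connected {V : Type*} [Fintype V] (G : SimpleGraph V)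
    (hG : G.Connected) (n : ℕ) (hn : Fintype.card V = n) (hn3 : 3 ≤ n) :
    sdiam G (n - 1) = (↑(n - 2) : ℕ∞) ↔ 2 ≤ kappa G := by
  have hS (S : Set V) (hS : S.ncard = n - 1) : (S.ncard : ℕ∞) = ((n - 2 : ℕ) : ℕ∞) + 1 := by
    rw [hS]
    exact_mod_cast (by omega : n - 1 = n - 2 + 1)
  have hcompl (v : V) : ({v}ᶜ : Set V).ncard = n - 1 := by
    rw [Set.ncard_compl, Set.ncard_singleton, Nat.card_eq_fintype_card, hn]
  rw [two_le_kappa_iff hG (hn ▸ hn3)]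
  constructor
  · intro h v
    rw [← steinerDist_add_one_le_ncard_iff, hS _ (hcompl v), ← h]
    gcongr
    exact le_sSup ⟨_, hcompl v, rfl⟩
  · intro h
    refine le_antisymm (sSup_le ?_) ?_
    · rintro m ⟨S, hcard, rfl⟩
      have hc : Sᶜ.ncard = 1 := by
        rw [Set.ncard_compl, hcard, Nat.card_eq_fintype_card, hn]
        omega
      obtain ⟨v, hv⟩ := Set.ncard_eq_one.1 hc
      have hle := (steinerDist_add_one_le_ncard_iff G S).2 (by
        rw [← compl_compl S, hv]
        exact h v)
      rw [hS S hcard] at hle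
      exact (ENat.add_le_add_iff_right ENat.one_ne_top).1 hle
    · obtain ⟨v⟩ := hG.nonempty
      have hle := ncard_le_steinerDist_add_one G {v}ᶜ
      rw [hS _ (hcompl v)] at hle
      exact ((ENat.add_le_add_iff_right ENat.one_ne_top).1 hle).trans
        (le_sSup ⟨_, hcompl v, rfl⟩)
end

section
/- Let G be a connected graph of order n ≥ 4. Then sdiam_{n−2}(G) = n − 3 if and only if κ(G) ≥ 3. -/
open SimpleGraph

namespace SimpleGraph

variable {V : Type*} {G : SimpleGraph V}

/-- A connected subgraph on `k` vertices has at least `k - 1` edges. -/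
lemma Subgraph.Connected.ncard_verts_le_s10 {H : G.Subgraph} (h : H.Connected) :
    H.verts.ncard ≤ H.edgeSet.ncard + 1 := by
  have h1 := h.coe.card_vert_le_card_edgeSet_add_one
  have h2 : Nat.card H.coe.edgeSet = H.edgeSet.ncard := by
    rw [← H.image_coe_edgeSet_coe, Set.ncard_image_of_injective _
      (Sym2.map.injective Subtype.val_injective), Nat.card_coe_set_eq]
  rwa [Nat.card_coe_set_eq, h2] at h1

/-- If `G.induce S` is connected, then `S` is spanned by a tree with `|S| - 1` edges. -/
lemma Connected.exists_subgraph_ncard_edgeSet [Finite V] {S : Set V} (h : (G.induce S).Connected) :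
    ∃ H : G.Subgraph, H.Connected ∧ H.verts = S ∧ H.edgeSet.ncard + 1 = S.ncard := by
  obtain ⟨T, hTG, hT⟩ := h.exists_isTree_le
  let H : G.Subgraph :=
    { verts := S
      Adj := fun a b => ∃ (ha : a ∈ S) (hb : b ∈ S), T.Adj ⟨a, ha⟩ ⟨b, hb⟩
      adj_sub := fun ⟨_, _, hab⟩ => hTG hab
      edge_vert := fun ⟨ha, _, _⟩ => ha
      symm := ⟨fun _ _ ⟨ha, hb, hab⟩ => ⟨hb, ha, hab.symm⟩⟩ }
  have hH : H.coe = T := by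
    ext ⟨a, ha⟩ ⟨b, hb⟩
    exact ⟨fun ⟨_, _, hab⟩ => hab, fun hab => ⟨ha, hb, hab⟩⟩
  refine ⟨H, ⟨hH ▸ hT.connected⟩, rfl, ?_⟩
  have hc := (isTree_iff_connected_and_card.1 hT).2
  rw [← H.image_coe_edgeSet_coe, Set.ncard_image_of_injective _
      (Sym2.map.injective Subtype.val_injective), ← Nat.card_coe_set_eq,
      ← Nat.card_coe_set_eq, hH]
  exact hc

end SimpleGraph

section

variable {V : Type*} [Finite V] {G : SimpleGraph V}

lemma le_steinerDist {S : Set V} {m : ℕ} (hS : S.ncard = m + 1) :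
    (m : ℕ∞) ≤ steinerDist G S := by
  refine le_sInf ?_
  rintro _ ⟨H, hH, hSH, rfl⟩
  have h1 := hH.ncard_verts_le_s10
  have h2 := Set.ncard_le_ncard hSH
  exact_mod_cast (by lia : m ≤ H.edgeSet.ncard)

lemma steinerDist_le_iff {S : Set V} {m : ℕ} (hS : S.ncard = m + 1) :
    steinerDist G S ≤ m ↔ (G.induce S).Connected := by
  constructor
  · intro h
    by_contra hc
    refine absurd h (not_le.2 ((ENat.add_one_le_iff (ENat.natCast_ne_top m)).1 (le_sInf ?_)))
    rintro _ ⟨H, hH, hSH, rfl⟩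
    have h1 := hH.ncard_verts_le_s10
    have h2 : S ⊂ H.verts :=
      hSH.ssubset_of_ne fun he => hc (he ▸ hH.induce_verts)
    have h3 := Set.ncard_lt_ncard h2
    exact_mod_cast (by lia : m + 1 ≤ H.edgeSet.ncard)
  · intro h
    obtain ⟨H, hH, rfl, hc⟩ := h.exists_subgraph_ncard_edgeSet
    refine sInf_le ⟨H, hH, subset_rfl, ?_⟩
    rw [show m = H.edgeSet.ncard by lia]

lemma sdiam_eq_iff {m : ℕ} (hm : m + 1 ≤ Nat.card V) :
    sdiam G (m + 1) = m ↔ ∀ S : Set V, S.ncard = m + 1 → (G.induce S).Connected := by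
  constructor
  · intro h S hS
    exact (steinerDist_le_iff hS).1 (h ▸ le_sSup ⟨S, hS, rfl⟩)
  · intro h
    refine le_antisymm (sSup_le ?_) ?_
    · rintro _ ⟨S, hS, rfl⟩
      exact (steinerDist_le_iff hS).2 (h S hS)
    · obtain ⟨S, -, hS⟩ := Set.exists_subset_card_eq (s := (Set.univ : Set V))
        (hm.trans_eq (Set.ncard_univ V).symm)
      exact (le_steinerDist hS).trans (le_sSup ⟨S, hS, rfl⟩)

lemma lt_kappa_iff {k : ℕ} (hk : k + 2 ≤ Nat.card V) :
    k < kappa G ↔ ∀ U : Set V, U.ncard ≤ k → (G.induce Uᶜ).Connected := by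
  constructor
  · intro h U hU
    by_contra hc
    refine Nat.notMem_of_lt_sInf (hU.trans_lt h) ⟨U, U.subset_univ, rfl, Or.inl ?_⟩
    rwa [← Set.compl_eq_univ_sdiff]
  · intro h
    rw [Nat.lt_iff_add_one_le, kappa, kappaOn]
    refine le_csInf ⟨_, Set.univ, subset_rfl, rfl, Or.inl fun hc => ?_⟩ ?_
    · obtain ⟨_, hx⟩ := hc.nonempty
      exact hx.2 hx.1
    · rintro _ ⟨U, -, rfl, hU⟩
      by_contra hlt
      rw [← Set.compl_eq_univ_sdiff] at hU
      have hadd := Set.ncard_add_ncard_compl U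
      rcases hU with hU | hU
      · exact hU (h U (by lia))
      · lia

/-- If deleting `U` and any one further vertex leaves a connected graph, and at least
three vertices lie outside `U`, then deleting `U` leaves a connected graph. -/
lemma connected_induce_compl_of_insert {U : Set V} (hU : 3 ≤ Uᶜ.ncard)
    (h : ∀ c ∉ U, (G.induce (insert c U)ᶜ).Connected) : (G.induce Uᶜ).Connected := by
  have hne : Uᶜ.Nonempty := Set.nonempty_of_ncard_ne_zero (by lia)
  have := hne.to_subtype
  refine ⟨fun a b => ?_⟩
  have hlt : ({a.1, b.1} : Set V).ncard < Uᶜ.ncard := by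
    have h1 := Set.ncard_insert_le a.1 {b.1}
    have h2 := Set.ncard_singleton b.1
    lia
  obtain ⟨c, hcU, hc⟩ := Set.exists_mem_notMem_of_ncard_lt_ncard hlt
  simp only [Set.mem_insert_iff, Set.mem_singleton_iff, not_or] at hc
  have ha : a.1 ∈ (insert c U)ᶜ := by
    rintro (h | h)
    exacts [hc.1 h.symm, a.2 h]
  have hb : b.1 ∈ (insert c U)ᶜ := by
    rintro (h | h)
    exacts [hc.2 h.symm, b.2 h]
  exact ((h c hcU).preconnected ⟨a, ha⟩ ⟨b, hb⟩).map
    (G.induceHomOfLE (Set.compl_subset_compl.2 (Set.subset_insert c U))).toHom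

lemma connected_induce_compl_of_ncard_le {k : ℕ} (hk : k + 2 ≤ Nat.card V)
    (h : ∀ U : Set V, U.ncard = k → (G.induce Uᶜ).Connected) {U : Set V} (hU : U.ncard ≤ k) :
    (G.induce Uᶜ).Connected := by
  induction hd : k - U.ncard generalizing U with
  | zero => exact h U (by lia)
  | succ d ih =>
    have hadd := Set.ncard_add_ncard_compl U
    refine connected_induce_compl_of_insert (by lia) fun c hc => ?_
    have hins := Set.ncard_insert_of_notMem hc
    exact ih (by lia) (by lia)

end

/-- For a connected graph `G` of order `n ≥ 4`, `sdiam_{n-2}(G) = n - 3`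
if and only if `κ(G) ≥ 3`. -/
theorem sdiam_sub_two_eq_iff_kappa {V : Type*} [Fintype V] (G : SimpleGraph V)
    (hG : G.Connected) (n : ℕ) (hn : Fintype.card V = n) (hn4 : 4 ≤ n) :
    sdiam G (n - 2) = (↑(n - 3) : ℕ∞) ↔ 3 ≤ kappa G := by
  have hcard : Nat.card V = n := Nat.card_eq_fintype_card.trans hn
  rw [show n - 2 = n - 3 + 1 by lia, sdiam_eq_iff (by lia), ← Nat.lt_iff_add_one_le,
    lt_kappa_iff (by lia)]
  constructor
  · intro h U hU
    refine connected_induce_compl_of_ncard_le (k := 2) (by lia) (fun W hW => h _ ?_) hU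
    have := Set.ncard_add_ncard_compl W
    lia
  · intro h S hS
    have := Set.ncard_add_ncard_compl S
    exact compl_compl S ▸ h Sᶜ (by lia)
end
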